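/- If a multiplicative function f : ℕ → ℂ satisfies f(p+q-2) = f(p) + f(q) - f(2) for all primes p and q, and f(2) = 1, then f(n) = 1 for all positive integers n. -/

import Mathlib

theorem Nat.factorial_dvd_pow_mul_prod_add_mul (q a n : ℕ) :
    n.factorial ∣ q ^ n * ∏ j ∈ Finset.range n, (a + j * q) := by
  rw [Nat.dvd_iff_prime_pow_dvd_dvd]
  intro p k hp hk
  by_cases hpq : p ∣ q
  · have : Fact p.Prime := ⟨hp⟩
    have hkn : k ≤ n := by
      have h1 : k ≤ padicValNat p n.factorial :=
        (padicValNat_dvd_iff_le n.factorial_ne_zero).1 hk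
      have h2 := sub_one_mul_padicValNat_factorial (p := p) n
      have h3 : 1 ≤ p - 1 := by have := hp.two_le; omega
      have h4 : padicValNat p n.factorial ≤ (p - 1) * padicValNat p n.factorial :=
        Nat.le_mul_of_pos_left _ h3
      omega
    exact ((pow_dvd_pow p hkn).trans (pow_dvd_pow_of_dvd hpq n)).mul_right _
  · have hcop : Nat.Coprime q (p ^ k) :=
      ((Nat.Prime.coprime_iff_not_dvd hp).2 hpq).symm.pow_right k
    obtain ⟨b, hb⟩ : ∃ b, q * b ≡ a [MOD p ^ k] := by
      rcases Nat.eq_zero_or_pos k with rfl | hk0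
      · exact ⟨0, by simpa using Nat.modEq_one⟩
      obtain ⟨c, -, hc⟩ := Nat.exists_mul_mod_eq_one_of_coprime hcop
        (Nat.one_lt_pow hk0.ne' hp.one_lt)
      have hc' : q * c ≡ 1 [MOD p ^ k] := by
        rw [Nat.ModEq, hc, Nat.mod_eq_of_lt (Nat.one_lt_pow hk0.ne' hp.one_lt)]
      exact ⟨c * a, by simpa [mul_assoc] using Nat.ModEq.mul_right a hc'⟩
    have key : ∏ j ∈ Finset.range n, (a + j * q) ≡
        ∏ j ∈ Finset.range n, (q * (b + j)) [MOD p ^ k] := by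
      refine Nat.ModEq.prod fun j _ => ?_
      rw [mul_add, mul_comm j q]
      exact Nat.ModEq.add_right _ hb.symm
    refine Dvd.dvd.mul_left ((key.dvd_iff dvd_rfl).2 ?_) _
    rw [Finset.prod_mul_distrib, ← Nat.ascFactorial_eq_prod_range]
    exact (hk.trans (Nat.factorial_dvd_ascFactorial b n)).mul_left _

theorem sum_log_primes_le_of_modEq (T : Finset ℕ) (x q : ℕ) (hq : 0 < q)
    (hT : ∀ t ∈ T, t.Prime ∧ t ≤ x) (hmod : ∀ t ∈ T, ∀ u ∈ T, t ≡ u [MOD q]) :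
    ∑ t ∈ T, Real.log t ≤ ((x : ℝ) / q + 1) * (2 * Real.log (2 * q)) := by
  have hq1 : (1 : ℝ) ≤ q := by exact_mod_cast hq
  have hlog : 0 ≤ 2 * Real.log (2 * q) := by
    have := Real.log_nonneg (x := 2 * (q : ℝ)) (by linarith)
    positivity
  rcases T.eq_empty_or_nonempty with rfl | ⟨t₀, ht₀⟩
  · simp only [Finset.sum_empty]; positivity
  set n := (x - 1) / q + 1 with hn
  set a := (t₀ - 1) % q + 1 with ha
  have haq : a ≤ q := Nat.mod_lt _ hq
  have hrep : ∀ t ∈ T, ∃ j < n, t = a + j * q := by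
    intro t ht
    have h1 := (hT t ht).1.one_lt
    have h0 := (hT t₀ ht₀).1.one_lt
    refine ⟨(t - 1) / q, ?_, ?_⟩
    · have := Nat.div_le_div_right (c := q)
        (show t - 1 ≤ x - 1 from Nat.sub_le_sub_right (hT t ht).2 1)
      omega
    · have h2 : (t - 1) % q = (t₀ - 1) % q := by
        have : t - 1 + 1 ≡ t₀ - 1 + 1 [MOD q] := by
          rw [Nat.sub_add_cancel h1.le, Nat.sub_add_cancel h0.le]; exact hmod t ht t₀ ht₀
        exact Nat.ModEq.add_right_cancel' 1 this
      have := Nat.mod_add_div (t - 1) q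
      rw [mul_comm] at this
      omega
  set P := ∏ j ∈ Finset.range n, (a + j * q) with hP
  have hPle : P ≤ q ^ n * n.factorial := by
    calc P ≤ ∏ j ∈ Finset.range n, (q * (j + 1)) :=
          Finset.prod_le_prod' fun j _ => by nlinarith
      _ = q ^ n * n.factorial := by
          rw [Finset.prod_mul_distrib, Finset.prod_range_add_one_eq_factorial]; simp
  have hPpos : 0 < P := Finset.prod_pos fun j _ => by omega
  have hbig : ∏ t ∈ T with n < t, t ≤ q ^ n * q ^ n := by
    have h1 : ∏ t ∈ T with n < t, t ∣ P := by
      refine Finset.prod_primes_dvd _ (fun t ht => ?_) (fun t ht => ?_)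
      · exact (hT t (Finset.mem_filter.1 ht).1).1.prime
      · obtain ⟨j, hj, rfl⟩ := hrep t (Finset.mem_filter.1 ht).1
        exact Finset.dvd_prod_of_mem (fun j => a + j * q) (Finset.mem_range.2 hj)
    have h2 : Nat.Coprime (∏ t ∈ T with n < t, t) n.factorial := by
      refine Nat.Coprime.prod_left fun t ht => ?_
      rw [Finset.mem_filter] at ht
      exact (Nat.coprime_factorial_iff (hT t ht.1).1.ne_one).2
        (by rw [(hT t ht.1).1.minFac_eq]; exact ht.2)
    have h3 := h2.mul_dvd_of_dvd_of_dvd (h1.mul_left (q ^ n))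
      (Nat.factorial_dvd_pow_mul_prod_add_mul q a n)
    have h4 := (Nat.le_of_dvd (by positivity) h3).trans (Nat.mul_le_mul_left (q ^ n) hPle)
    rw [← mul_assoc] at h4
    exact Nat.le_of_mul_le_mul_right h4 n.factorial_pos
  have hsmall : ∏ t ∈ T with ¬ n < t, t ≤ 4 ^ n := by
    refine le_trans ?_ (primorial_le_four_pow n)
    refine Finset.prod_le_prod_of_subset_of_one_le' (fun t ht => ?_) (fun t ht _ => ?_)
    · rw [Finset.mem_filter] at ht
      simp only [Finset.mem_filter, Finset.mem_range]
      exact ⟨by omega, (hT t ht.1).1⟩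
    · exact (Finset.mem_filter.1 ht).2.one_lt.le
  have hprod : ∏ t ∈ T, t ≤ ((2 * q) ^ 2) ^ n := by
    rw [← Finset.prod_filter_mul_prod_filter_not T (fun t => n < t)]
    calc _ ≤ (q ^ n * q ^ n) * 4 ^ n := Nat.mul_le_mul hbig hsmall
      _ = _ := by rw [← mul_pow, ← mul_pow]; ring
  have hne : ∀ t ∈ T, (t : ℝ) ≠ 0 := fun t ht => by exact_mod_cast (hT t ht).1.ne_zero
  rw [← Real.log_prod hne]
  have hpos : (0 : ℝ) < ∏ t ∈ T, (t : ℝ) :=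
    Finset.prod_pos fun t ht => by exact_mod_cast (hT t ht).1.pos
  have hnx : (n : ℝ) ≤ (x : ℝ) / q + 1 := by
    rw [hn]; push_cast
    have h1 : (((x - 1) / q : ℕ) : ℝ) ≤ ((x - 1 : ℕ) : ℝ) / q := Nat.cast_div_le
    have h2 : ((x - 1 : ℕ) : ℝ) ≤ x := by exact_mod_cast Nat.sub_le x 1
    have h3 : ((x - 1 : ℕ) : ℝ) / q ≤ x / q := by gcongr
    linarith
  calc Real.log (∏ t ∈ T, (t : ℝ)) ≤ Real.log (((2 * q) ^ 2) ^ n) :=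
        Real.log_le_log hpos (by rw [← Nat.cast_prod]; exact_mod_cast hprod)
    _ = n * (2 * Real.log (2 * q)) := by rw [Real.log_pow, Real.log_pow]; norm_num
    _ ≤ _ := by gcongr

theorem sum_Ioc_log_div_sq_le {L : ℝ} (hL : 0 ≤ L) {M R : ℕ} (hM : 8 ≤ M) (hR : M ≤ R) :
    ∑ l ∈ Finset.Ioc M R, (L + 2 * Real.log l) / (l : ℝ) ^ 2 ≤
      (L + 2 * Real.log M + 2) / M - (L + 2 * Real.log R + 2) / R := by
  induction R, hR using Nat.le_induction with
  | base => simp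
  | succ n hn ih =>
    rw [← Nat.succ_eq_add_one, Finset.sum_Ioc_succ_top (by omega)]
    suffices (L + 2 * Real.log (n.succ : ℕ)) / ((n.succ : ℕ) : ℝ) ^ 2 ≤
        (L + 2 * Real.log n + 2) / n - (L + 2 * Real.log (n.succ : ℕ) + 2) / (n.succ : ℕ) by
      linarith
    have hn8 : (8 : ℝ) ≤ n := by exact_mod_cast hM.trans hn
    push_cast
    set y := (n : ℝ)
    have hlog : 2 ≤ Real.log (y + 1) := by
      rw [Real.le_log_iff_exp_le (by linarith)]
      have h1 : Real.exp 2 = Real.exp 1 ^ 2 := by rw [← Real.exp_nat_mul]; norm_num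
      rw [h1]
      nlinarith [Real.exp_one_lt_d9, Real.exp_pos 1]
    have hdiff : Real.log (y + 1) - 1 / y ≤ Real.log y := by
      have h1 := Real.log_le_sub_one_of_pos (x := (y + 1) / y) (by positivity)
      rw [Real.log_div (by linarith) (by linarith)] at h1
      have h2 : (y + 1) / y - 1 = 1 / y := by field_simp; ring
      linarith
    set z := Real.log (y + 1)
    have h3 : (L + 2 * (z - 1 / y) + 2) / y ≤ (L + 2 * Real.log y + 2) / y := by gcongr
    have h4 : (L + 2 * z) / (y + 1) ^ 2 ≤
        (L + 2 * (z - 1 / y) + 2) / y - (L + 2 * z + 2) / (y + 1) := by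
      have hy : 0 < y := by linarith
      have : (L + 2 * (z - 1 / y) + 2) / y - (L + 2 * z + 2) / (y + 1) - (L + 2 * z) / (y + 1) ^ 2
          = (L * y + 2 * z * y - 2 * (y + 1)) / (y ^ 2 * (y + 1) ^ 2) := by
        field_simp
        ring
      have h5 : 0 ≤ (L * y + 2 * z * y - 2 * (y + 1)) / (y ^ 2 * (y + 1) ^ 2) := by
        apply div_nonneg _ (by positivity)
        nlinarith [mul_nonneg hL hy.le]
      linarith
    linarith

theorem sum_log_div_le {K N M : ℕ} {Q : ℕ → ℕ} {S : Finset ℕ} (hK : 0 < K) (hM : 8 ≤ M)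
    (hMN : M ^ 2 ≤ N) (hQN : ∀ l ∈ S, N ≤ Q l) (hQ : ∀ l ∈ S, l ^ 2 ≤ Q l) (hS : ∀ l ∈ S, 0 < l) :
    ∑ l ∈ S, 2 * Real.log (2 * (K * Q l : ℕ)) / Q l ≤
      2 / M * (Real.log (2 * K * N) + Real.log (2 * K) + 2 * Real.log M + 2) := by
  have hK1 : (1 : ℝ) ≤ K := by exact_mod_cast hK
  have hM8 : (8 : ℝ) ≤ M := by exact_mod_cast hM
  have hanti : ∀ y z : ℝ, 2 ≤ y → y ≤ z → Real.log (2 * K * z) / z ≤ Real.log (2 * K * y) / y := by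
    intro y z hy hyz
    have he : ∀ u : ℝ, 2 ≤ u → Real.exp 1 ≤ 2 * K * u := fun u hu => by
      nlinarith [Real.exp_one_lt_d9]
    have h1 := Real.log_div_self_antitoneOn (Set.mem_Ici.2 (he y hy))
      (Set.mem_Ici.2 (he z (hy.trans hyz))) (by gcongr)
    simp only at h1
    have h2 : ∀ u : ℝ, 2 ≤ u → Real.log (2 * K * u) / u =
        2 * K * (Real.log (2 * K * u) / (2 * K * u)) := fun u hu => by
      have : u ≠ 0 := by linarith
      field_simp
    rw [h2 y hy, h2 z (hy.trans hyz)]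
    gcongr
  have hN : (M : ℝ) ^ 2 ≤ N := by exact_mod_cast hMN
  have hN2 : (2 : ℝ) ≤ N := by nlinarith
  have hL : 0 ≤ Real.log (2 * K) := Real.log_nonneg (by linarith)
  have hLN : 0 ≤ Real.log (2 * K * N) := Real.log_nonneg (by nlinarith)
  have hlogM : 0 ≤ Real.log M := Real.log_nonneg (by linarith)
  have hsmall : ∑ l ∈ S with l ≤ M, Real.log (2 * (K * Q l : ℕ)) / Q l ≤
      1 / M * Real.log (2 * K * N) := by
    calc _ ≤ ∑ l ∈ S with l ≤ M, Real.log (2 * K * N) / N := by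
          refine Finset.sum_le_sum fun l hl => ?_
          rw [Nat.cast_mul, ← mul_assoc]
          exact hanti _ _ hN2 (by exact_mod_cast hQN l (Finset.mem_filter.1 hl).1)
      _ ≤ M * (Real.log (2 * K * N) / N) := by
          rw [Finset.sum_const, nsmul_eq_mul]
          have hcard : (S.filter (· ≤ M)).card ≤ M := by
            calc _ ≤ (Finset.Icc 1 M).card := Finset.card_le_card fun l hl => by
                  rw [Finset.mem_filter] at hl
                  exact Finset.mem_Icc.2 ⟨hS l hl.1, hl.2⟩
              _ = M := by simp
          gcongr
      _ ≤ M * (Real.log (2 * K * N) / M ^ 2) := by gcongr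
      _ = _ := by field_simp
  have hlarge : ∑ l ∈ S with ¬ l ≤ M, Real.log (2 * (K * Q l : ℕ)) / Q l ≤
      1 / M * (Real.log (2 * K) + 2 * Real.log M + 2) := by
    calc _ ≤ ∑ l ∈ S with ¬ l ≤ M, (Real.log (2 * K) + 2 * Real.log l) / (l : ℝ) ^ 2 := by
          refine Finset.sum_le_sum fun l hl => ?_
          rw [Finset.mem_filter] at hl
          have hl8 : (8 : ℝ) ≤ l := by exact_mod_cast (by omega : 8 ≤ l)
          have h1 := hanti ((l : ℝ) ^ 2) (Q l) (by nlinarith) (by exact_mod_cast hQ l hl.1)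
          have h2 : Real.log (2 * K * (l : ℝ) ^ 2) = Real.log (2 * K) + 2 * Real.log l := by
            rw [Real.log_mul (by positivity) (by positivity), Real.log_pow]; norm_num
          rw [Nat.cast_mul, ← mul_assoc, ← h2]
          exact h1
      _ ≤ ∑ l ∈ Finset.Ioc M (M + S.sup id), (Real.log (2 * K) + 2 * Real.log l) / (l : ℝ) ^ 2 := by
          refine Finset.sum_le_sum_of_subset_of_nonneg (fun l hl => ?_) fun l _ _ => ?_
          · rw [Finset.mem_filter] at hl
            have : l ≤ S.sup id := Finset.le_sup (f := id) hl.1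
            exact Finset.mem_Ioc.2 ⟨by omega, by omega⟩
          · have := Real.log_natCast_nonneg l
            positivity
      _ ≤ _ := sum_Ioc_log_div_sq_le hL hM (by omega)
      _ ≤ _ := by
          have := Real.log_natCast_nonneg (M + S.sup id)
          have : 0 ≤ (Real.log (2 * K) + 2 * Real.log (M + S.sup id : ℕ) + 2) /
              (M + S.sup id : ℕ) := by
            positivity
          rw [one_div_mul_eq_div]
          linarith
  simp only [mul_div_assoc]
  rw [← Finset.mul_sum, ← Finset.sum_filter_add_sum_filter_not S (· ≤ M)]
  calc _ ≤ 2 * (1 / M * Real.log (2 * K * N) +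
        1 / M * (Real.log (2 * K) + 2 * Real.log M + 2)) := by
        gcongr
    _ = _ := by ring

theorem sum_log_primes_le_of_fibers {K N M x X : ℕ} {Q c : ℕ → ℕ} {P : Finset ℕ} (hK : 0 < K)
    (hM : 8 ≤ M) (hMN : M ^ 2 ≤ N) (hP : ∀ t ∈ P, t.Prime ∧ t ≤ x)
    (hc : ∀ t ∈ P, 0 < c t ∧ N ≤ Q (c t) ∧ c t ^ 2 ≤ Q (c t) ∧ Q (c t) ≤ X)
    (hmod : ∀ t ∈ P, ∀ u ∈ P, c t = c u → t ≡ u [MOD K * Q (c t)]) :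
    ∑ t ∈ P, Real.log t ≤
      x / K * (2 / M * (Real.log (2 * K * N) + Real.log (2 * K) + 2 * Real.log M + 2)) +
        √X * (2 * Real.log (2 * K * X)) := by
  have hN0 : 0 < N := lt_of_lt_of_le (by positivity) hMN
  rw [← Finset.sum_fiberwise_of_maps_to (t := P.image c) fun t ht => Finset.mem_image_of_mem c ht]
  have himg : ∀ l ∈ P.image c, 0 < l ∧ N ≤ Q l ∧ l ^ 2 ≤ Q l ∧ Q l ≤ X := by
    simpa [Finset.forall_mem_image] using hc
  have hfib : ∀ l ∈ P.image c, ∑ t ∈ P with c t = l, Real.log t ≤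
      x / K * (2 * Real.log (2 * (K * Q l : ℕ)) / Q l) + 2 * Real.log (2 * K * X) := by
    intro l hl
    obtain ⟨hl0, hQN, -, hQX⟩ := himg l hl
    have hQ0 : 0 < Q l := hN0.trans_le hQN
    have h1 := sum_log_primes_le_of_modEq (P.filter fun t => c t = l) x (K * Q l) (by positivity)
      (fun t ht => hP t (Finset.mem_filter.1 ht).1) fun t ht u hu => by
        rw [Finset.mem_filter] at ht hu
        have := hmod t ht.1 u hu.1 (ht.2.trans hu.2.symm)
        rwa [ht.2] at this
    have hKR : (0 : ℝ) < K := by exact_mod_cast hK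
    have hQR : (0 : ℝ) < Q l := by exact_mod_cast hQ0
    have h2 : Real.log (2 * (K * Q l : ℕ)) ≤ Real.log (2 * K * X) := by
      rw [Nat.cast_mul, ← mul_assoc]
      gcongr
    refine h1.trans ?_
    rw [add_mul, one_mul]
    refine add_le_add (le_of_eq ?_) (by linarith)
    push_cast
    field_simp
  refine (Finset.sum_le_sum hfib).trans ?_
  rw [Finset.sum_add_distrib, ← Finset.mul_sum, Finset.sum_const, nsmul_eq_mul]
  have h3 := sum_log_div_le (K := K) (Q := Q) (S := P.image c) hK hM hMN
    (fun l hl => (himg l hl).2.1) (fun l hl => (himg l hl).2.2.1) (fun l hl => (himg l hl).1)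
  have hcard : ((P.image c).card : ℝ) ≤ √X := by
    refine le_trans ?_ Real.nat_sqrt_le_real_sqrt
    have : (P.image c).card ≤ (Finset.Icc 1 (Nat.sqrt X)).card :=
      Finset.card_le_card fun l hl => by
        obtain ⟨hl0, -, hQ, hQX⟩ := himg l hl
        exact Finset.mem_Icc.2 ⟨hl0, Nat.le_sqrt'.2 (hQ.trans hQX)⟩
    rw [Nat.card_Icc, Nat.add_sub_cancel] at this
    exact_mod_cast this
  have hlog : 0 ≤ 2 * Real.log (2 * K * X) := by
    have := Real.log_natCast_nonneg (2 * K * X)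
    push_cast at this
    positivity
  gcongr

theorem sum_range_mul_le_of_antitone {b w : ℕ → ℝ} {δ C : ℝ} (hw : Antitone w) (hw0 : ∀ n, 0 ≤ w n)
    (hC : 0 ≤ C) (hb : ∀ k : ℕ, ∑ n ∈ Finset.range k, b n ≤ δ * k + C) (k : ℕ) :
    ∑ n ∈ Finset.range k, b n * w n ≤ δ * ∑ n ∈ Finset.range k, w n + C * w 0 := by
  have hD : ∀ k : ℕ, ∑ n ∈ Finset.range k, (b n - δ) ≤ C := fun k => by
    have := hb k
    simp only [Finset.sum_sub_distrib, Finset.sum_const, Finset.card_range, nsmul_eq_mul]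
    linarith
  have key : ∀ k : ℕ, ∑ n ∈ Finset.range (k + 1), (b n - δ) * w n ≤
      C * w 0 + (∑ n ∈ Finset.range (k + 1), (b n - δ) - C) * w k := by
    intro k
    induction k with
    | zero => simpa using le_of_eq (by ring)
    | succ k ih =>
      rw [Finset.sum_range_succ, Finset.sum_range_succ (fun n => b n - δ) (k + 1)]
      have h1 := hD (k + 1)
      have h2 := hw (Nat.le_succ k)
      nlinarith [mul_nonneg (sub_nonneg.2 h1) (sub_nonneg.2 h2)]
  have h3 : ∑ n ∈ Finset.range k, (b n - δ) * w n ≤ C * w 0 := by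
    cases k with
    | zero => simpa using mul_nonneg hC (hw0 0)
    | succ k => nlinarith [key k, hD (k + 1), hw0 k]
  simp only [sub_mul, Finset.sum_sub_distrib, ← Finset.mul_sum] at h3
  linarith

open Filter Topology ArithmeticFunction in
theorem inv_totient_le_of_sum_log_le {q : ℕ} [NeZero q] {a : ZMod q} (ha : IsUnit a) {δ C : ℝ}
    (hδ : 0 ≤ δ) (hC : 0 ≤ C)
    (h : ∀ n : ℕ, ∑ t ∈ (Finset.range (n + 1)).filter (fun t : ℕ => t.Prime ∧ (t : ZMod q) = a),
      Real.log (t : ℕ)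
      ≤ δ * n + C) :
    (q.totient : ℝ)⁻¹ ≤ δ := by
  obtain ⟨C', hC'⟩ := vonMangoldt.LSeries_residueClass_lower_bound ha
  set b : ℕ → ℝ := fun n => if n.Prime ∧ (n : ZMod q) = a then Real.log n else 0 with hb
  set e : ℕ → ℝ := fun n => if n.Prime then 0 else vonMangoldt.residueClass a n with he
  have hsplit : ∀ n, vonMangoldt.residueClass a n = e n + b n := by
    intro n
    by_cases hn : n.Prime
    · by_cases hna : (n : ZMod q) = a
      · simp [he, hb, hn, hna, vonMangoldt.residueClass, vonMangoldt_apply_prime hn]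
      · simp [he, hb, hn, hna, vonMangoldt.residueClass]
    · simp [he, hb, hn]
  have hb0 : ∀ n, 0 ≤ b n := fun n => by
    simp only [hb]; split_ifs
    · exact Real.log_natCast_nonneg n
    · rfl
  have he0 : ∀ n, 0 ≤ e n := fun n => by
    simp only [he]; split_ifs
    · rfl
    · exact vonMangoldt.residueClass_nonneg a n
  have hesum : Summable fun n : ℕ => e n / n := vonMangoldt.summable_residueClass_non_primes_div a
  have hbsum : ∀ k : ℕ, ∑ n ∈ Finset.range k, b (n + 1) ≤ δ * k + C := by
    intro k
    have h1 := h k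
    rw [Finset.sum_filter, Finset.sum_range_succ'] at h1
    simpa [hb, Nat.not_prime_zero] using h1
  have hrpow : ∀ {x : ℝ}, 1 < x → ∀ n : ℕ, (n : ℝ) ≤ (n : ℝ) ^ x := by
    intro x hx n
    rcases Nat.eq_zero_or_pos n with rfl | hn
    · simp [(by linarith : x ≠ 0)]
    · exact Real.self_le_rpow_of_one_le (by exact_mod_cast hn) hx.le
  have hmain : ∀ x ∈ Set.Ioc (1 : ℝ) 2,
      (q.totient : ℝ)⁻¹ / (x - 1) - C' ≤
        ∑' n, e n / n + (δ * ∑' n : ℕ, 1 / (n : ℝ) ^ x + C) := by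
    intro x hx
    have hx0 : x ≠ 0 := by linarith [hx.1]
    refine (hC' hx).trans ?_
    have hle : ∀ n : ℕ, e n / (n : ℝ) ^ x ≤ e n / n := by
      intro n
      rcases Nat.eq_zero_or_pos n with rfl | hn
      · simp [hx0]
      · exact div_le_div_of_nonneg_left (he0 n) (by exact_mod_cast hn) (hrpow hx.1 n)
    have hes : Summable fun n : ℕ => e n / (n : ℝ) ^ x :=
      Summable.of_nonneg_of_le (fun n => div_nonneg (he0 n) (by positivity)) hle hesum
    have hzs : Summable fun n : ℕ => 1 / (n : ℝ) ^ x := Real.summable_one_div_nat_rpow.2 hx.1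
    have hpart : ∀ k : ℕ, ∑ n ∈ Finset.range k, b n / (n : ℝ) ^ x ≤
        δ * ∑ n ∈ Finset.range k, 1 / (n : ℝ) ^ x + C := by
      intro k
      cases k with
      | zero => simpa using hC
      | succ k =>
        rw [Finset.sum_range_succ', Finset.sum_range_succ' (fun n : ℕ => 1 / (n : ℝ) ^ x)]
        have := sum_range_mul_le_of_antitone (b := fun n => b (n + 1))
          (w := fun n => 1 / ((n + 1 : ℕ) : ℝ) ^ x) (δ := δ) (C := C)
          (fun m n hmn => by
            dsimp only
            gcongr
            linarith [hx.1]) (fun n => by positivity) hC hbsum k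
        simpa [hb, Nat.not_prime_zero, hx0, div_eq_mul_inv] using this
    have hpart' : ∀ k : ℕ, ∑ n ∈ Finset.range k, b n / (n : ℝ) ^ x ≤
        δ * ∑' n : ℕ, 1 / (n : ℝ) ^ x + C := fun k => (hpart k).trans <| by
      gcongr
      exact hzs.sum_le_tsum _ fun n _ => by positivity
    have hbpos : ∀ n : ℕ, 0 ≤ b n / (n : ℝ) ^ x := fun n => div_nonneg (hb0 n) (by positivity)
    have hbs : Summable fun n : ℕ => b n / (n : ℝ) ^ x := summable_of_sum_range_le hbpos hpart'
    simp_rw [hsplit, add_div]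
    rw [hes.tsum_add hbs]
    exact add_le_add (hes.tsum_le_tsum hle hesum) (Real.tsum_le_of_sum_range_le hbpos hpart')
  have hlim : Tendsto (fun x : ℝ => (x - 1) * (∑' n, e n / n + C + C')
      + δ * ((x - 1) * ∑' n : ℕ, 1 / (n : ℝ) ^ x)) (𝓝[>] 1)
        (𝓝 (0 * (∑' n, e n / n + C + C') + δ * 1)) := by
    refine Tendsto.add (Tendsto.mul_const _ ?_) (tendsto_sub_mul_tsum_nat_rpow.const_mul δ)
    refine tendsto_nhdsWithin_of_tendsto_nhds ?_
    simpa using (continuous_id.sub continuous_const).tendsto (1 : ℝ) (f := fun x : ℝ => x - 1)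
  rw [zero_mul, zero_add, mul_one] at hlim
  refine ge_of_tendsto hlim ?_
  filter_upwards [Ioc_mem_nhdsGT (show (1 : ℝ) < 2 by norm_num)] with x hx
  have h1 := hmain x hx
  have hx1 : 0 < x - 1 := sub_pos.2 hx.1
  rw [sub_le_iff_le_add, div_le_iff₀ hx1] at h1
  linarith

/-- Trial division of `n` by `d, d + 1, …`, giving up after `fuel` steps. -/
def noDivisorFrom (n : ℕ) : ℕ → ℕ → Bool
  | 0, _ => false
  | fuel + 1, d => Nat.blt n (d * d) || (!(n % d == 0) && noDivisorFrom n fuel (d + 1))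

theorem not_dvd_of_noDivisorFrom {n fuel d : ℕ} (h : noDivisorFrom n fuel d = true) {m : ℕ}
    (hdm : d ≤ m) (hm : m * m ≤ n) : ¬ m ∣ n := by
  induction fuel generalizing d with
  | zero => simp [noDivisorFrom] at h
  | succ fuel ih =>
    simp only [noDivisorFrom, Bool.or_eq_true, Nat.blt_eq, Bool.and_eq_true, Bool.not_eq_true',
      beq_eq_false_iff_ne] at h
    rcases h with h | ⟨h1, h2⟩
    · nlinarith
    · rcases hdm.eq_or_lt with rfl | hlt
      · exact fun hdvd => h1 (Nat.mod_eq_zero_of_dvd hdvd)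
      · exact ih h2 hlt

/-- A sufficient test for primality. -/
def primeTest (n : ℕ) : Bool := Nat.ble 2 n && noDivisorFrom n 500 2

theorem prime_of_primeTest {n : ℕ} (h : primeTest n = true) : n.Prime := by
  simp only [primeTest, Bool.and_eq_true, Nat.ble_eq] at h
  exact Nat.prime_def_le_sqrt.2
    ⟨h.1, fun m hm hmn => not_dvd_of_noDivisorFrom h.2 hm (Nat.le_sqrt.1 hmn)⟩

/-- Searches for primes `u ≥ r` and `v ≥ 7` with `u + v = n`. -/
def goldbachSearch (n : ℕ) : ℕ → ℕ → Bool
  | 0, _ => false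
  | fuel + 1, r =>
    (primeTest r && primeTest (n - r) && Nat.ble (r + 7) n) || goldbachSearch n fuel (r + 1)

theorem exists_primes_of_goldbachSearch {n fuel r : ℕ} (h : goldbachSearch n fuel r = true) :
    ∃ u v : ℕ, u.Prime ∧ v.Prime ∧ r ≤ u ∧ 7 ≤ v ∧ u + v = n := by
  induction fuel generalizing r with
  | zero => simp [goldbachSearch] at h
  | succ fuel ih =>
    simp only [goldbachSearch, Bool.or_eq_true, Bool.and_eq_true, Nat.ble_eq] at h
    rcases h with ⟨⟨h1, h2⟩, h3⟩ | h
    · exact ⟨r, n - r, prime_of_primeTest h1, prime_of_primeTest h2, le_rfl, by omega, by omega⟩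
    · obtain ⟨u, v, hu, hv, hru, h⟩ := ih h
      exact ⟨u, v, hu, hv, by omega, h⟩

/-- The even number whose Goldbach representation determines the value at `l ^ k`. -/
def goldbachTarget (l k : ℕ) : ℕ := if l = 2 then l ^ k + 2 else 2 * l ^ k + 2

theorem goldbachSearch_goldbachTarget {l k : ℕ} (hl : l.Prime) (hk : 2 ≤ k)
    (h9 : 9 ≤ l ^ k) (hlk : l ^ k < 100000) :
    goldbachSearch (goldbachTarget l k) 1000 7 = true := by
  have key : ((List.range 317).all fun l => (List.range 17).all fun k =>
      ([2, 3, 5, 7, 11, 13, 17].any fun d => l % d == 0 && !(l == d)) ||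
        Nat.blt k 2 || Nat.blt (l ^ k) 9 || Nat.ble 100000 (l ^ k) ||
        goldbachSearch (goldbachTarget l k) 1000 7) = true := by
    decide +kernel
  have hl2 := hl.two_le
  have hl317 : l < 317 := by
    by_contra h
    have h1 : 317 ^ 2 ≤ l ^ 2 := Nat.pow_le_pow_left (by omega) 2
    have h2 : l ^ 2 ≤ l ^ k := Nat.pow_le_pow_right (by omega) hk
    omega
  have hk17 : k < 17 := by
    by_contra h
    have h1 : 2 ^ 17 ≤ 2 ^ k := Nat.pow_le_pow_right (by omega) (by omega)
    have h2 : 2 ^ k ≤ l ^ k := Nat.pow_le_pow_left hl2 k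
    omega
  have h1 := List.all_eq_true.1 (List.all_eq_true.1 key l (List.mem_range.2 hl317)) k
    (List.mem_range.2 hk17)
  have hdvd : ∀ d : ℕ, d ≠ 1 → l % d = 0 → l = d := fun d hd h =>
    ((hl.eq_one_or_self_of_dvd d (Nat.dvd_of_mod_eq_zero h)).resolve_left hd).symm
  have hany : ([2, 3, 5, 7, 11, 13, 17].any fun d => l % d == 0 && !(l == d)) = false := by
    rw [List.any_eq_false]
    intro d hd
    have hd1 : d ≠ 1 := by rintro rfl; simp at hd
    simpa using hdvd d hd1
  rw [hany] at h1
  have hk2 : Nat.blt k 2 = false := by rw [Bool.eq_false_iff, Ne, Nat.blt_eq]; omega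
  have hlk9 : Nat.blt (l ^ k) 9 = false := by rw [Bool.eq_false_iff, Ne, Nat.blt_eq]; omega
  have hlk' : Nat.ble 100000 (l ^ k) = false := by rw [Bool.eq_false_iff, Ne, Nat.ble_eq]; omega
  simpa only [hk2, hlk9, hlk', Bool.false_or] using h1

/-- Multiplicative functions with `f 2 = 1` satisfying `f (p + q - 2) = f p + f q - 1` on primes. -/
structure IsPrimeShiftAdditive (f : ℕ → ℂ) : Prop where
  map_one : f 1 = 1
  map_mul : ∀ m n : ℕ, Nat.Coprime m n → f (m * n) = f m * f n
  map_add_sub_two : ∀ p q : ℕ, p.Prime → q.Prime → f (p + q - 2) = f p + f q - 1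
  map_two : f 2 = 1

namespace IsPrimeShiftAdditive

variable {f : ℕ → ℂ}

theorem exists_prime_pow_ne_one (hf : IsPrimeShiftAdditive f) {n : ℕ} (hn : 0 < n)
    (h : f n ≠ 1) : ∃ p k : ℕ, p.Prime ∧ 0 < k ∧ p ^ k ∣ n ∧ f (p ^ k) ≠ 1 := by
  by_contra! hc
  refine h ?_
  rw [Nat.multiplicative_factorization f (fun x y => hf.map_mul x y) hf.map_one hn.ne']
  refine Finset.prod_eq_one fun p hp => ?_
  have hp' := Nat.prime_of_mem_primeFactors hp
  exact hc p _ hp' (hp'.factorization_pos_of_dvd hn.ne' (Nat.dvd_of_mem_primeFactors hp))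
    (Nat.ordProj_dvd n p)

theorem map_three_and_five_and_seven (hf : IsPrimeShiftAdditive f) :
    f 3 = 1 ∧ f 5 = 1 ∧ f 7 = 1 := by
  have h35 := hf.map_add_sub_two 3 5 (by norm_num) (by norm_num)
  have h55 := hf.map_add_sub_two 5 5 (by norm_num) (by norm_num)
  have h37 := hf.map_add_sub_two 3 7 (by norm_num) (by norm_num)
  have h57 := hf.map_add_sub_two 5 7 (by norm_num) (by norm_num)
  have h6 := hf.map_mul 2 3 (by norm_num)
  have h10 := hf.map_mul 2 5 (by norm_num)
  norm_num at h35 h55 h37 h57 h6 h10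
  rw [hf.map_two] at h6 h10
  have h5 : f 5 = 1 := by linear_combination h6 - h35
  have h7 : f 7 = 1 := by linear_combination h10 - h57
  exact ⟨by linear_combination h55 - h37 + 2 * h5 - h7, h5, h7⟩

theorem map_prime_add_one (hf : IsPrimeShiftAdditive f) {p : ℕ} (hp : p.Prime) :
    f (p + 1) = f p := by
  have h := hf.map_add_sub_two p 3 hp (by norm_num)
  rw [hf.map_three_and_five_and_seven.1] at h
  simpa using h

theorem map_prime_of_forall_le (hf : IsPrimeShiftAdditive f) {p : ℕ} (hp : p.Prime) (hp5 : 5 ≤ p)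
    (h : ∀ m, 0 < m → 2 * m ≤ p + 3 → f m = 1) : f p = 1 := by
  have hodd := hp.eq_two_or_odd
  have hhalf : ∀ m, m % 2 = 1 → 2 * m ≤ p + 3 → f (2 * m) = 1 := fun m hm hmp => by
    rw [hf.map_mul 2 m ((Nat.coprime_two_left).2 (Nat.odd_iff.2 hm)), hf.map_two,
      h m (by omega) hmp, one_mul]
  rcases (by omega : p % 4 = 1 ∨ p % 4 = 3) with h4 | h4
  · rw [← hf.map_prime_add_one hp, show p + 1 = 2 * ((p + 1) / 2) by omega]
    exact hhalf _ (by omega) (by omega)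
  · have h5 := hf.map_add_sub_two p 5 hp (by norm_num)
    rw [hf.map_three_and_five_and_seven.2.1, show p + 5 - 2 = 2 * ((p + 3) / 2) by omega,
      hhalf _ (by omega) (by omega)] at h5
    linear_combination -h5

theorem map_eq_one_of_lt (hf : IsPrimeShiftAdditive f) {n : ℕ} (hn0 : 0 < n) (hn : n < 100000) :
    f n = 1 := by
  induction n using Nat.strong_induction_on with
  | _ n ih =>
    obtain ⟨h3, h5, h7⟩ := hf.map_three_and_five_and_seven
    by_contra hne
    obtain ⟨p, k, hp, hk, hdvd, hpk⟩ := hf.exists_prime_pow_ne_one hn0 hne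
    have hle := Nat.le_of_dvd hn0 hdvd
    obtain rfl : n = p ^ k := by
      by_contra hne'
      exact hpk (ih _ (by omega) (pow_pos hp.pos k) (by omega))
    have hprime : ∀ u : ℕ, u.Prime → 7 ≤ u → u + 3 < 2 * p ^ k → f u = 1 := fun u hu hu7 hlt =>
      hf.map_prime_of_forall_le hu (by omega) fun m hm hmu => ih m (by omega) hm (by omega)
    rcases Nat.lt_or_ge k 2 with hk2 | hk2
    · obtain rfl : k = 1 := by omega
      rw [pow_one] at *
      rcases Nat.lt_or_ge p 7 with h | h
      · interval_cases p <;>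
          first | exact hpk hf.map_two | exact hpk h3 | exact hpk h5 | norm_num at hp
      · exact hpk (hprime p hp h (by omega))
    rcases Nat.lt_or_ge (p ^ k) 9 with h9 | h9
    · have hsq : 2 ^ 2 ≤ p ^ k :=
        (Nat.pow_le_pow_left hp.two_le 2).trans (Nat.pow_le_pow_right hp.pos hk2)
      have h33 := hf.map_add_sub_two 3 3 (by norm_num) (by norm_num)
      have h37 := hf.map_add_sub_two 3 7 (by norm_num) (by norm_num)
      have h23 := hf.map_mul 2 3 (by norm_num)
      norm_num [h3, h7, hf.map_two] at h33 h37 h23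
      generalize p ^ k = n at *
      interval_cases n <;> simp_all
    · obtain ⟨u, v, hu, hv, hu7, hv7, huv⟩ := exists_primes_of_goldbachSearch
        (goldbachSearch_goldbachTarget hp hk2 h9 hn)
      have hadd := hf.map_add_sub_two u v hu hv
      unfold goldbachTarget at huv
      split_ifs at huv with hp2
      · rw [hprime u hu hu7 (by omega), hprime v hv hv7 (by omega),
          show u + v - 2 = p ^ k by omega] at hadd
        exact hpk (by linear_combination hadd)
      · rw [hprime u hu hu7 (by omega), hprime v hv hv7 (by omega),
          show u + v - 2 = 2 * p ^ k by omega, hf.map_mul 2 (p ^ k)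
          (((Nat.coprime_primes Nat.prime_two hp).2 (Ne.symm hp2)).pow_right k), hf.map_two] at hadd
        exact hpk (by linear_combination hadd)

end IsPrimeShiftAdditive

/-- The least power `l ^ k` with `2 ≤ k` and `N ≤ l ^ k`. -/
def leastPowGe (N l : ℕ) : ℕ := l ^ max 2 (Nat.clog l N)

theorem le_leastPowGe (N : ℕ) {l : ℕ} (hl : 1 < l) : N ≤ leastPowGe N l :=
  (Nat.le_pow_clog hl N).trans (Nat.pow_le_pow_right hl.le (le_max_right _ _))

theorem sq_le_leastPowGe (N : ℕ) {l : ℕ} (hl : 0 < l) : l ^ 2 ≤ leastPowGe N l :=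
  Nat.pow_le_pow_right hl (le_max_left _ _)

theorem leastPowGe_dvd_pow {N l k : ℕ} (hk : 2 ≤ k) (hN : N ≤ l ^ k) :
    leastPowGe N l ∣ l ^ k :=
  pow_dvd_pow l (max_le hk (Nat.clog_le_of_le_pow hN))

theorem Real.log_le_linear {y : ℝ} (hy : 0 < y) : Real.log y ≤ y / 512 + 5.24 := by
  have h1 := Real.log_le_sub_one_of_pos (x := y / 512) (by positivity)
  have h2 : Real.log 512 = 9 * Real.log 2 := by
    rw [show (512 : ℝ) = 2 ^ (9 : ℕ) by norm_num, Real.log_pow]; norm_num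
  rw [Real.log_div hy.ne' (by norm_num), h2] at h1
  linarith [Real.log_two_lt_d9]

theorem theta_gt_of_large {s : ℕ} (hs : 100000 ≤ s) :
    (s : ℝ) / (1 : ℕ) * (2 / (316 : ℕ) * (Real.log (2 * (1 : ℕ) * (100000 : ℕ)) +
      Real.log (2 * (1 : ℕ)) + 2 * Real.log (316 : ℕ) + 2)) +
        √(2 * s : ℕ) * (2 * Real.log (2 * (1 : ℕ) * (2 * s : ℕ))) <
      Chebyshev.theta s - Real.log 2 - Real.log s := by
  have hsR : (100000 : ℝ) ≤ s := by exact_mod_cast hs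
  set y := √(s : ℝ) with hy
  have hy2 : (s : ℝ) = y ^ 2 := (Real.sq_sqrt (by positivity)).symm
  have hy316 : (316 : ℝ) ≤ y := Real.le_sqrt_of_sq_le (by linarith)
  have hly := Real.log_le_linear (y := y) (by linarith)
  have hly0 : 0 ≤ Real.log y := Real.log_nonneg (by linarith)
  have hl2 := Real.log_two_lt_d9
  have hl2' := Real.log_two_gt_d9
  have hlogs : Real.log s = 2 * Real.log y := by rw [hy2, Real.log_pow]; norm_num
  have hlogs1 : Real.log (s + 1) ≤ 2 * Real.log y + Real.log 2 := by
    rw [← hlogs, ← Real.log_mul (by positivity) (by norm_num)]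
    exact Real.log_le_log (by positivity) (by linarith)
  have hlog4s : Real.log (2 * (1 : ℕ) * (2 * s : ℕ)) = 2 * Real.log 2 + 2 * Real.log y := by
    push_cast
    rw [← hlogs, show (2 : ℝ) * 1 * (2 * s) = 2 ^ 2 * s by ring,
      Real.log_mul (by positivity) (by positivity), Real.log_pow]
    norm_num
  have hsqrt : √((2 * s : ℕ) : ℝ) ≤ 1.415 * y := by
    rw [Real.sqrt_le_left (by positivity)]
    push_cast
    rw [hy2]
    nlinarith
  have h316 : Real.log (316 : ℕ) ≤ 9 * Real.log 2 := by
    rw [show 9 * Real.log 2 = Real.log (2 ^ 9) by rw [Real.log_pow]; norm_num]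
    exact Real.log_le_log (by norm_num) (by norm_num)
  have h200 : Real.log (2 * (1 : ℕ) * (100000 : ℕ)) ≤ 18 * Real.log 2 := by
    rw [show 18 * Real.log 2 = Real.log (2 ^ 18) by rw [Real.log_pow]; norm_num]
    exact Real.log_le_log (by norm_num) (by norm_num)
  have htheta := Chebyshev.theta_ge s
  have hfst : (s : ℝ) / (1 : ℕ) * (2 / (316 : ℕ) * (Real.log (2 * (1 : ℕ) * (100000 : ℕ)) +
      Real.log (2 * (1 : ℕ)) + 2 * Real.log (316 : ℕ) + 2)) ≤ 0.2 * y ^ 2 := by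
    rw [hy2, Nat.cast_one, div_one, mul_comm, mul_one]
    rw [Nat.cast_one, mul_one] at h200
    have key : ∀ a b : ℝ, a ≤ 18 * Real.log 2 → b ≤ 9 * Real.log 2 →
        2 / 316 * (a + Real.log 2 + 2 * b + 2) ≤ 0.2 := fun a b ha hb => by linarith
    exact mul_le_mul_of_nonneg_right (key _ _ h200 h316) (by positivity)
  have hsnd : √(2 * s : ℕ) * (2 * Real.log (2 * (1 : ℕ) * (2 * s : ℕ))) ≤
      1.415 * y * (2 * (2 * Real.log 2 + 2 * Real.log y)) := by
    rw [hlog4s]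
    gcongr
  rw [← hy, hlogs] at htheta
  rw [hlogs]
  refine lt_of_le_of_lt (add_le_add hfst hsnd) ?_
  have hmul : y * Real.log y ≤ y * (y / 512 + 5.24) := by gcongr
  nlinarith

namespace IsPrimeShiftAdditive

variable {f : ℕ → ℂ}

theorem map_prime (hf : IsPrimeShiftAdditive f) {s : ℕ} (hs : s.Prime) : f s = 1 := by
  induction s using Nat.strong_induction_on with
  | _ s ih =>
    rcases Nat.lt_or_ge s 100000 with hlt | hs5
    · exact hf.map_eq_one_of_lt hs.pos hlt
    by_contra hne
    have hsodd := hs.eq_two_or_odd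
    set P := (Finset.range s).filter (fun r => r.Prime ∧ 3 ≤ r) with hP
    have hmem : ∀ r ∈ P, r < s ∧ r.Prime ∧ 3 ≤ r := fun r hr => by simpa [hP] using hr
    have hex : ∀ r ∈ P, ∃ l : ℕ, 1 < l ∧ leastPowGe 100000 l ∣ s + r - 2 := by
      intro r hr
      obtain ⟨hrs, hrp, hr3⟩ := hmem r hr
      have hval : f (s + r - 2) ≠ 1 := by
        rw [hf.map_add_sub_two s r hs hrp, ih r hrs hrp]
        simpa using hne
      obtain ⟨l, k, hl, hk, hdvd, hlk⟩ := hf.exists_prime_pow_ne_one (by omega) hval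
      have hrodd := hrp.eq_two_or_odd
      have hk2 : 2 ≤ k := by
        by_contra hk2
        obtain rfl : k = 1 := by omega
        rw [pow_one] at hdvd hlk
        have hl2 : l ≠ 2 := by rintro rfl; exact hlk hf.map_two
        rw [show s + r - 2 = 2 * ((s + r - 2) / 2) by omega,
          Nat.Coprime.dvd_mul_left ((Nat.coprime_primes hl Nat.prime_two).2 hl2)] at hdvd
        have := Nat.le_of_dvd (by omega) hdvd
        exact hlk (ih l (by omega) hl)
      refine ⟨l, hl.one_lt, (leastPowGe_dvd_pow hk2 ?_).trans hdvd⟩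
      by_contra hlt
      exact hlk (hf.map_eq_one_of_lt (pow_pos hl.pos k) (by omega))
    choose! c hc1 hc2 using hex
    have hbound := sum_log_primes_le_of_fibers (K := 1) (N := 100000) (M := 316) (x := s)
      (X := 2 * s) (Q := leastPowGe 100000) (c := c) (P := P) one_pos (by norm_num) (by norm_num)
      (fun r hr => ⟨(hmem r hr).2.1, (hmem r hr).1.le⟩)
      (fun r hr => ⟨by have := hc1 r hr; omega, le_leastPowGe _ (hc1 r hr),
        sq_le_leastPowGe _ (by have := hc1 r hr; omega), by
          have := hmem r hr
          have := Nat.le_of_dvd (by omega) (hc2 r hr)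
          omega⟩)
      (fun r hr u hu hru => by
        have hr3 := (hmem r hr).2.2
        have hu3 := (hmem u hu).2.2
        have h1 := (Nat.modEq_zero_iff_dvd).2 (hc2 r hr)
        have h2 := (Nat.modEq_zero_iff_dvd).2 (hc2 u hu)
        rw [← hru] at h2
        have h3 := h1.trans h2.symm
        rw [show s + r - 2 = (s - 2) + r by omega, show s + u - 2 = (s - 2) + u by omega] at h3
        rw [one_mul]
        exact Nat.ModEq.add_left_cancel' _ h3)
    have htheta : Chebyshev.theta s = ∑ r ∈ P, Real.log r + Real.log 2 + Real.log s := by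
      rw [Chebyshev.theta_eq_sum_Icc, Nat.floor_natCast]
      have : (Finset.Icc 0 s).filter Nat.Prime = insert s (insert 2 P) := by
        ext r
        simp only [hP, Finset.mem_filter, Finset.mem_Icc, Finset.mem_insert, Finset.mem_range]
        constructor
        · rintro ⟨h, hr⟩
          have := hr.two_le
          grind
        · rintro (rfl | rfl | h)
          · exact ⟨by omega, hs⟩
          · exact ⟨by omega, Nat.prime_two⟩
          · exact ⟨by omega, h.2.1⟩
      rw [this, Finset.sum_insert, Finset.sum_insert]
      · push_cast; ring
      · simp [hP]
      · simp only [hP, Finset.mem_insert, Finset.mem_filter, Finset.mem_range]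
        omega
    have := theta_gt_of_large hs5
    linarith

theorem two_div_sqrt_mul_logs_le_half {M N p : ℕ} (hM : M = Nat.sqrt N) (hN : 100000 ≤ N)
    (hp0 : 0 < p) (hp : p ^ 2 ≤ N) :
    2 / M * (Real.log (2 * (p * N : ℕ) * N) + Real.log (2 * (p * N : ℕ)) + 2 * Real.log M + 2) ≤
      1 / 2 := by
  have hM316 : 316 ≤ M := by rw [hM]; exact Nat.le_sqrt'.2 (by omega)
  have hNM : N ≤ (M + 1) ^ 2 := by rw [hM]; exact (Nat.lt_succ_sqrt' N).le
  have hpM : p ≤ M + 1 := by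
    rw [hM]; exact (Nat.le_sqrt'.2 hp).trans (Nat.le_succ _)
  have hMR : (316 : ℝ) ≤ M := by exact_mod_cast hM316
  have hly := Real.log_le_linear (y := (M : ℝ) + 1) (by linarith)
  have hl2 := Real.log_two_lt_d9
  have h1 : Real.log (2 * (p * N : ℕ) * N) ≤ Real.log 2 + 5 * Real.log ((M : ℝ) + 1) := by
    have : (2 * (p * N : ℕ) * N : ℝ) ≤ 2 * ((M : ℝ) + 1) ^ 5 := by
      have : 2 * (p * N) * N ≤ 2 * (M + 1) ^ 5 := by
        calc _ ≤ 2 * ((M + 1) * (M + 1) ^ 2) * (M + 1) ^ 2 := by gcongr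
          _ = _ := by ring
      exact_mod_cast this
    refine (Real.log_le_log (by positivity) this).trans_eq ?_
    rw [Real.log_mul (by norm_num) (by positivity), Real.log_pow]; norm_num
  have h2 : Real.log (2 * (p * N : ℕ)) ≤ Real.log 2 + 3 * Real.log ((M : ℝ) + 1) := by
    have : (2 * (p * N : ℕ) : ℝ) ≤ 2 * ((M : ℝ) + 1) ^ 3 := by
      have : 2 * (p * N) ≤ 2 * (M + 1) ^ 3 := by
        calc _ ≤ 2 * ((M + 1) * (M + 1) ^ 2) := by gcongr
          _ = _ := by ring
      exact_mod_cast this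
    refine (Real.log_le_log (by positivity) this).trans_eq ?_
    rw [Real.log_mul (by norm_num) (by positivity), Real.log_pow]; norm_num
  have h3 : Real.log M ≤ Real.log ((M : ℝ) + 1) := Real.log_le_log (by linarith) (by linarith)
  rw [div_mul_eq_mul_div, div_le_iff₀ (by linarith)]
  linarith

theorem sqrt_mul_log_le {K : ℕ} (hK : 0 < K) {ε : ℝ} (hε : 0 < ε) :
    ∃ C, 0 ≤ C ∧ ∀ x : ℕ, √(x + 1 : ℕ) * (2 * Real.log (2 * K * (x + 1 : ℕ))) ≤ ε * x + C := by
  set L := |Real.log (2 * K)|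
  set B := 2 * L + 32 / ε with hB
  refine ⟨B ^ 2 / (2 * ε) + ε, by positivity, fun x => ?_⟩
  set z : ℝ := ((x + 1 : ℕ) : ℝ) with hz
  have hz0 : 0 < z := by positivity
  have hxz : (x : ℝ) = z - 1 := by rw [hz]; push_cast; ring
  set w := √√z with hw
  have hw0 : 0 < w := by positivity
  have hw2 : √z = w ^ 2 := (Real.sq_sqrt (by positivity)).symm
  have hw4 : z = w ^ 4 := by
    rw [show w ^ 4 = (w ^ 2) ^ 2 by ring, ← hw2, Real.sq_sqrt hz0.le]
  have hlog : Real.log (2 * K * z) ≤ L + 4 * w := by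
    rw [Real.log_mul (by positivity) hz0.ne', hw4, Real.log_pow]
    have := le_abs_self (Real.log (2 * K))
    have := Real.log_le_self hw0.le
    push_cast
    linarith
  have h1 : 8 * w ≤ ε / 2 * w ^ 2 + 32 / ε := by
    have : ε / 2 * w ^ 2 + 32 / ε - 8 * w = (ε * w - 8) ^ 2 / (2 * ε) := by field_simp; ring
    have : 0 ≤ (ε * w - 8) ^ 2 / (2 * ε) := by positivity
    linarith
  have h2 : B * w ^ 2 ≤ ε / 2 * w ^ 4 + B ^ 2 / (2 * ε) := by
    have : ε / 2 * w ^ 4 + B ^ 2 / (2 * ε) - B * w ^ 2 = (ε * w ^ 2 - B) ^ 2 / (2 * ε) := by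
      field_simp; ring
    have : 0 ≤ (ε * w ^ 2 - B) ^ 2 / (2 * ε) := by positivity
    linarith
  calc √z * (2 * Real.log (2 * K * z)) ≤ w ^ 2 * (2 * (L + 4 * w)) := by rw [hw2]; gcongr
    _ = w ^ 2 * (2 * L + 8 * w) := by ring
    _ ≤ w ^ 2 * (2 * L + (ε / 2 * w ^ 2 + 32 / ε)) := by gcongr
    _ = ε / 2 * w ^ 4 + B * w ^ 2 := by rw [hB]; ring
    _ ≤ ε * x + (B ^ 2 / (2 * ε) + ε) := by rw [hxz, hw4]; linarith

theorem map_prime_pow (hf : IsPrimeShiftAdditive f) {p a : ℕ} (hp : p.Prime) (ha : 2 ≤ a) :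
    f (p ^ a) = 1 := by
  by_contra hne
  obtain ⟨N, ⟨p, a, hp, ha, rfl, hne⟩, hmin⟩ :
      ∃ N, (∃ p a : ℕ, p.Prime ∧ 2 ≤ a ∧ N = p ^ a ∧ f N ≠ 1) ∧
        ∀ m < N, ¬ ∃ p a : ℕ, p.Prime ∧ 2 ≤ a ∧ m = p ^ a ∧ f m ≠ 1 := by
    classical
    have hex : ∃ N, ∃ p a : ℕ, p.Prime ∧ 2 ≤ a ∧ N = p ^ a ∧ f N ≠ 1 :=
      ⟨_, p, a, hp, ha, rfl, hne⟩
    exact ⟨Nat.find hex, Nat.find_spec hex, fun m => Nat.find_min hex⟩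
  set N := p ^ a with hN
  have hNpos : 0 < N := pow_pos hp.pos a
  have hN5 : 100000 ≤ N := by
    by_contra h
    exact hne (hf.map_eq_one_of_lt hNpos (by omega))
  have hpN2 : p ^ 2 ≤ N := Nat.pow_le_pow_right hp.pos ha
  have hpN : p ∣ N := dvd_pow_self p (by omega)
  have hK : 0 < p * N := Nat.mul_pos hp.pos hNpos
  have : NeZero (p * N) := ⟨hK.ne'⟩
  have hunit : IsUnit ((N - 1 : ℕ) : ZMod (p * N)) := by
    rw [ZMod.isUnit_iff_coprime]
    have h1 : Nat.Coprime (N - 1) N := by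
      have := (Nat.coprime_self_add_right (m := N - 1) (n := 1)).2 (Nat.coprime_one_right _)
      rwa [Nat.sub_add_cancel hNpos] at this
    exact Nat.Coprime.mul_right (h1.coprime_dvd_right hpN) h1
  obtain ⟨C, hC0, hC⟩ := sqrt_mul_log_le hK (ε := 1 / (4 * (p * N : ℕ))) (by positivity)
  have hclass : ∀ x : ℕ, ∑ t ∈ (Finset.range (x + 1)).filter
      (fun t : ℕ => t.Prime ∧ (t : ZMod (p * N)) = ((N - 1 : ℕ) : ZMod (p * N))),
      Real.log (t : ℕ) ≤ (3 / (4 * (p * N : ℕ))) * x + C := by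
    intro x
    set P := (Finset.range (x + 1)).filter
      (fun t : ℕ => t.Prime ∧ (t : ZMod (p * N)) = ((N - 1 : ℕ) : ZMod (p * N))) with hP
    have hmem : ∀ t ∈ P, t ≤ x ∧ t.Prime ∧ t ≡ N - 1 [MOD p * N] := fun t ht => by
      rw [hP, Finset.mem_filter, Finset.mem_range, ZMod.natCast_eq_natCast_iff] at ht
      exact ⟨by omega, ht.2⟩
    have hex : ∀ t ∈ P, ∃ l : ℕ, l.Prime ∧ l ≠ p ∧ leastPowGe N l ∣ t + 1 := by
      intro t ht
      obtain ⟨-, htp, htm⟩ := hmem t ht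
      have htm' : t + 1 ≡ N [MOD p * N] := by
        have := htm.add_right 1
        rwa [Nat.sub_add_cancel hNpos] at this
      obtain ⟨m, hm⟩ : N ∣ t + 1 := (htm'.dvd_iff (Dvd.intro_left p rfl)).2 dvd_rfl
      have hm1 : m ≡ 1 [MOD p] := by
        rw [hm, mul_comm p N] at htm'
        exact Nat.ModEq.mul_left_cancel' hNpos.ne' (by simpa using htm')
      have hpm : ¬ p ∣ m := fun h =>
        hp.one_lt.ne' (Nat.dvd_one.1 ((hm1.dvd_iff dvd_rfl).1 h))
      have hcop : Nat.Coprime N m := ((Nat.Prime.coprime_iff_not_dvd hp).2 hpm).pow_left a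
      have hfm : f m ≠ 1 := by
        intro hfm
        have h1 := hf.map_mul N m hcop
        rw [← hm, hf.map_prime_add_one htp, hf.map_prime htp, hfm, mul_one] at h1
        exact hne h1.symm
      obtain ⟨l, k, hl, hk, hdvd, hlk⟩ := hf.exists_prime_pow_ne_one
        (Nat.pos_of_ne_zero (by rintro rfl; simp at hm)) hfm
      have hk2 : 2 ≤ k := by
        by_contra hk2
        obtain rfl : k = 1 := by omega
        rw [pow_one] at hlk
        exact hlk (hf.map_prime hl)
      refine ⟨l, hl, ?_, ((leastPowGe_dvd_pow hk2 ?_).trans hdvd).trans (Dvd.intro_left N hm.symm)⟩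
      · rintro rfl
        exact hpm ((dvd_pow_self l hk.ne').trans hdvd)
      · by_contra hlt
        exact hmin _ (by omega) ⟨l, k, hl, hk2, rfl, hlk⟩
    choose! c hc1 hc2 hc3 using hex
    have hbound := sum_log_primes_le_of_fibers (K := p * N) (N := N) (M := Nat.sqrt N) (x := x)
      (X := x + 1) (Q := leastPowGe N) (c := c) (P := P) hK (Nat.le_sqrt'.2 (by omega))
      (Nat.sqrt_le' N) (fun t ht => ⟨(hmem t ht).2.1, (hmem t ht).1⟩)
      (fun t ht => ⟨(hc1 t ht).pos, le_leastPowGe _ (hc1 t ht).one_lt,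
        sq_le_leastPowGe _ (hc1 t ht).pos, by
          have := (hmem t ht).1
          have := Nat.le_of_dvd (by omega) (hc3 t ht)
          omega⟩)
      (fun t ht u hu htu => by
        have hcop : Nat.Coprime (p * N) (leastPowGe N (c t)) := by
          have h1 : Nat.Coprime p (leastPowGe N (c t)) :=
            ((Nat.coprime_primes hp (hc1 t ht)).2 (hc2 t ht).symm).pow_right _
          exact Nat.Coprime.mul_left h1 (h1.pow_left a)
        refine (Nat.modEq_and_modEq_iff_modEq_mul hcop).1
          ⟨(hmem t ht).2.2.trans (hmem u hu).2.2.symm, ?_⟩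
        have h1 := (Nat.modEq_zero_iff_dvd).2 (hc3 t ht)
        have h2 := (Nat.modEq_zero_iff_dvd).2 (hc3 u hu)
        rw [← htu] at h2
        exact Nat.ModEq.add_right_cancel' 1 (h1.trans h2.symm))
    refine hbound.trans ?_
    have h1 := two_div_sqrt_mul_logs_le_half rfl hN5 hp.pos hpN2
    have h2 := hC x
    calc _ ≤ (x : ℝ) / (p * N : ℕ) * (1 / 2) + (1 / (4 * (p * N : ℕ)) * x + C) := by gcongr
      _ = _ := by
        have : ((p * N : ℕ) : ℝ) ≠ 0 := by exact_mod_cast hK.ne'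
        field_simp
        ring
  have hle := inv_totient_le_of_sum_log_le hunit (by positivity) hC0 hclass
  have htot : ((p * N).totient : ℝ) ≤ (p * N : ℕ) := by exact_mod_cast Nat.totient_le _
  have htot0 : (0 : ℝ) < (p * N).totient := by exact_mod_cast Nat.totient_pos.2 hK
  have h3 : ((p * N : ℕ) : ℝ)⁻¹ ≤ ((p * N).totient : ℝ)⁻¹ := inv_anti₀ htot0 htot
  have h4 : 0 < ((p * N : ℕ) : ℝ)⁻¹ := by positivity
  have h5 : 3 / (4 * ((p * N : ℕ) : ℝ)) = 3 / 4 * ((p * N : ℕ) : ℝ)⁻¹ := by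
    rw [div_mul_eq_div_div, div_eq_mul_inv]
  rw [h5] at hle
  linarith

end IsPrimeShiftAdditive

theorem stmt_14 (f : ℕ → ℂ)
    (hf1 : f 1 = 1)
    (hmul : ∀ m n : ℕ, Nat.Coprime m n → f (m * n) = f m * f n)
    (heq : ∀ p q : ℕ, p.Prime → q.Prime → f (p + q - 2) = f p + f q - f 2)
    (hf2 : f 2 = 1) :
    ∀ n : ℕ, 0 < n → f n = 1 := by
  have hf : IsPrimeShiftAdditive f := ⟨hf1, hmul, fun p q hp hq => hf2 ▸ heq p q hp hq, hf2⟩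
  intro n hn
  by_contra hne
  obtain ⟨p, k, hp, hk, -, hpk⟩ := hf.exists_prime_pow_ne_one hn hne
  rcases Nat.lt_or_ge k 2 with hk2 | hk2
  · obtain rfl : k = 1 := by omega
    rw [pow_one] at hpk
    exact hpk (hf.map_prime hp)
  · exact hpk (hf.map_prime_pow hp hk2)
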